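/- Let s > 0 and σ > 0 be real constants. Let X₀ be an integrable real-valued random variable and let ε be a random variable with standard Gaussian law independent of X₀. Define Xₜ = s·X₀ + s·σ·ε and let pₜ(x) = ∫ φ(x; s·x₀, s²σ²) d(law of X₀)(x₀) be the density of Xₜ, where φ(·; m, v) denotes the Lebesgue density of the Gaussian with mean m and variance v. Then Tweedie's formula holds: almost surely, E[X₀ | Xₜ] = Xₜ/s + s·σ²·(log pₜ)′(Xₜ). -/

import Mathlib

open MeasureTheory ProbabilityTheory

lemma gaussianPDFReal_le (m : ℝ) (v : NNReal) (x : ℝ) :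
    gaussianPDFReal m v x ≤ (√(2 * Real.pi * v))⁻¹ := by
  rw [gaussianPDFReal]
  refine mul_le_of_le_one_right (by positivity) (Real.exp_le_one_iff.2 ?_)
  exact div_nonpos_of_nonpos_of_nonneg (by nlinarith [sq_nonneg (x - m)]) (by positivity)

lemma hasDerivAt_gaussianPDFReal (m : ℝ) (v : NNReal) (x : ℝ) :
    HasDerivAt (gaussianPDFReal m v) (-((x - m) / v) * gaussianPDFReal m v x) x := by
  rw [gaussianPDFReal_def]
  have h : HasDerivAt (fun y : ℝ => -(y - m) ^ 2 / (2 * v)) (-((x - m) / v)) x := by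
    refine ((((hasDerivAt_id' x).sub_const m).fun_pow 2).fun_neg.div_const
      (2 * (v : ℝ))).congr_deriv ?_
    by_cases hv : (v : ℝ) = 0
    · simp [hv]
    · simp
      field_simp
  refine (h.exp.const_mul (√(2 * Real.pi * v))⁻¹).congr_deriv ?_
  ring

lemma measurable_gaussianPDFReal_const_mul_uncurry (s : ℝ) (v : NNReal) :
    Measurable fun z : ℝ × ℝ => gaussianPDFReal (s * z.1) v z.2 :=
  measurable_uncurry_gaussianPDFReal.comp
    (f := fun z : ℝ × ℝ => (s * z.1, v, z.2)) (by fun_prop)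

lemma measurable_gaussianPDFReal_const_mul (s : ℝ) (v : NNReal) (x : ℝ) :
    Measurable fun a => gaussianPDFReal (s * a) v x :=
  (measurable_gaussianPDFReal_const_mul_uncurry s v).comp
    (g := fun z : ℝ × ℝ => gaussianPDFReal (s * z.1) v z.2) (f := fun a : ℝ => (a, x))
    (by fun_prop)

lemma integrable_gaussianPDFReal_const_mul (μ : Measure ℝ) [IsFiniteMeasure μ]
    (s : ℝ) (v : NNReal) (x : ℝ) :
    Integrable (fun a => gaussianPDFReal (s * a) v x) μ := by
  refine Integrable.of_bound (C := (√(2 * Real.pi * v))⁻¹)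
    (measurable_gaussianPDFReal_const_mul s v x).aestronglyMeasurable (.of_forall fun a => ?_)
  rw [Real.norm_of_nonneg (gaussianPDFReal_nonneg _ _ _)]
  exact gaussianPDFReal_le _ _ _

/-- Differentiation under the integral sign for the density of a Gaussian mixture over the mean. -/
lemma hasDerivAt_integral_gaussianPDFReal (μ : Measure ℝ) [IsFiniteMeasure μ]
    (hμ : Integrable id μ) (s : ℝ) (v : NNReal) (x : ℝ) :
    HasDerivAt (fun y => ∫ a, gaussianPDFReal (s * a) v y ∂μ)
      (∫ a, -((x - s * a) / v) * gaussianPDFReal (s * a) v x ∂μ) x := by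
  have hmeas : AEStronglyMeasurable
      (fun a => -((x - s * a) / v) * gaussianPDFReal (s * a) v x) μ := by
    have hsub : Measurable fun a : ℝ => -((x - s * a) / v) := by fun_prop
    exact (hsub.mul (measurable_gaussianPDFReal_const_mul s v x)).aestronglyMeasurable
  have hbound : Integrable
      (fun a => (|x| + 1 + |s| * |a|) / v * (√(2 * Real.pi * v))⁻¹) μ := by
    have habs : Integrable (fun a : ℝ => |a|) μ := hμ.abs
    exact (((integrable_const _).add (habs.const_mul _)).div_const _).mul_const _
  refine (hasDerivAt_integral_of_dominated_loc_of_deriv_le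
    (F := fun y a => gaussianPDFReal (s * a) v y)
    (F' := fun y a => -((y - s * a) / v) * gaussianPDFReal (s * a) v y)
    (Metric.ball_mem_nhds x one_pos)
    (.of_forall fun y => (measurable_gaussianPDFReal_const_mul s v y).aestronglyMeasurable)
    (integrable_gaussianPDFReal_const_mul μ s v x) hmeas (.of_forall fun a y hy => ?_) hbound
    (.of_forall fun a y _ => hasDerivAt_gaussianPDFReal _ _ _)).2
  rw [norm_mul, norm_neg, norm_div, Real.norm_of_nonneg (gaussianPDFReal_nonneg _ _ _),
    Real.norm_of_nonneg v.coe_nonneg, Real.norm_eq_abs]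
  have hy' : |y| ≤ |x| + 1 := by
    rw [Metric.mem_ball, Real.dist_eq] at hy
    have := abs_sub_abs_le_abs_sub y x
    linarith
  have hsub : |y - s * a| ≤ |x| + 1 + |s| * |a| := by
    have := abs_sub y (s * a)
    rw [abs_mul] at this
    linarith
  gcongr
  · exact gaussianPDFReal_nonneg _ _ _
  · exact gaussianPDFReal_le _ _ _

/-- The joint law of `X` and `s X + c Z`, with `Z` standard Gaussian independent of `X`. -/
lemma map_prodMk_add_gaussian {Ω : Type*} [MeasurableSpace Ω] {P : Measure Ω}
    [IsProbabilityMeasure P] {X Z : Ω → ℝ} (hX : Measurable X) (hZ : Measurable Z)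
    (hlaw : P.map Z = gaussianReal 0 1) (hindep : IndepFun X Z P) (s c : ℝ) (v : NNReal)
    (hv : v ≠ 0) (hcv : (v : ℝ) = c ^ 2) :
    P.map (fun ω => (X ω, s * X ω + c * Z ω)) =
      ((P.map X).prod volume).withDensity fun z => gaussianPDF (s * z.1) v z.2 := by
  have : IsProbabilityMeasure (P.map X) := Measure.isProbabilityMeasure_map hX.aemeasurable
  have hmap (a : ℝ) : (gaussianReal 0 1).map (fun z => s * a + c * z)
      = gaussianReal (s * a) v := by
    have h : (fun z => s * a + c * z) = (fun y => s * a + y) ∘ (fun z => c * z) := rfl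
    rw [h, ← Measure.map_map (by fun_prop) (by fun_prop), gaussianReal_map_const_mul,
      gaussianReal_map_const_add]
    congr 1
    · simp
    · ext
      simp [hcv]
  have hK : Measurable fun z : ℝ × ℝ => gaussianPDF (s * z.1) v z.2 :=
    (measurable_gaussianPDFReal_const_mul_uncurry s v).ennreal_ofReal
  have hjoint := (indepFun_iff_map_prod_eq_prod_map_map hX.aemeasurable hZ.aemeasurable).1 hindep
  have hcomp : (fun ω => (X ω, s * X ω + c * Z ω))
      = (fun z : ℝ × ℝ => (z.1, s * z.1 + c * z.2)) ∘ fun ω => (X ω, Z ω) := rfl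
  rw [hcomp, ← Measure.map_map (by fun_prop) (by fun_prop), hjoint, hlaw]
  refine Measure.ext_of_lintegral _ fun f hf => ?_
  rw [lintegral_map hf (by fun_prop), lintegral_prod _ (by fun_prop),
    lintegral_withDensity_eq_lintegral_mul _ hK hf, lintegral_prod _ (by fun_prop)]
  refine lintegral_congr fun a => ?_
  have h := lintegral_map (μ := gaussianReal 0 1) (f := fun x => f (a, x))
    (g := fun z => s * a + c * z) (by fun_prop) (by fun_prop)
  rw [← h, hmap, gaussianReal_of_var_ne_zero _ hv,
    lintegral_withDensity_eq_lintegral_mul _ (measurable_gaussianPDF _ _) (by fun_prop)]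
  rfl

open MeasureTheory ProbabilityTheory

/-- Tweedie's formula: `E[X₀ | Xₜ] = Xₜ/s + s σ² (log pₜ)'(Xₜ)` almost surely, where
`Xₜ = s X₀ + s σ ε` with `ε` standard Gaussian independent of `X₀`, and `pₜ` is the
marginal density of `Xₜ`. -/
theorem tweedie_formula
    {Ω : Type*} [MeasurableSpace Ω] (P : Measure Ω) [IsProbabilityMeasure P]
    (s σ : ℝ) (hs : 0 < s) (hσ : 0 < σ)
    (X₀ ε : Ω → ℝ) (hX₀ : Measurable X₀) (hX₀int : Integrable X₀ P) (hε : Measurable ε)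
    (hεlaw : Measure.map ε P = gaussianReal 0 1)
    (hindep : IndepFun X₀ ε P)
    (Xt : Ω → ℝ) (hXt : ∀ ω, Xt ω = s * X₀ ω + s * σ * ε ω)
    (pt : ℝ → ℝ)
    (hpt : ∀ x, pt x = ∫ x₀, gaussianPDFReal (s * x₀) ((s ^ 2 * σ ^ 2).toNNReal) x
      ∂(Measure.map X₀ P)) :
    P[X₀ | MeasurableSpace.comap Xt (by infer_instance)]
      =ᵐ[P] fun ω => Xt ω / s + s * σ ^ 2 * deriv (fun x => Real.log (pt x)) (Xt ω) := by
  set μ := P.map X₀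
  set v := (s ^ 2 * σ ^ 2).toNNReal
  have hv_coe : (v : ℝ) = s ^ 2 * σ ^ 2 := Real.coe_toNNReal _ (by positivity)
  have hv : v ≠ 0 := (Real.toNNReal_pos.2 (by positivity)).ne'
  have : IsProbabilityMeasure μ := Measure.isProbabilityMeasure_map hX₀.aemeasurable
  have hμint : Integrable id μ :=
    (integrable_map_measure (by fun_prop) hX₀.aemeasurable).2 hX₀int
  obtain rfl : Xt = fun ω => s * X₀ ω + s * σ * ε ω := funext hXt
  obtain rfl : pt = fun x => ∫ a, gaussianPDFReal (s * a) v x ∂μ := funext hpt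
  have hXt_meas : Measurable fun ω => s * X₀ ω + s * σ * ε ω := by fun_prop
  set Xt := fun ω => s * X₀ ω + s * σ * ε ω
  set p : ℝ → ℝ := fun x => ∫ a, gaussianPDFReal (s * a) v x ∂μ with hp_def
  set N : ℝ → ℝ := fun x => ∫ a, gaussianPDFReal (s * a) v x * a ∂μ with hN_def
  set q : ℝ → ℝ := fun x => x / s + s * σ ^ 2 * deriv (fun x => Real.log (p x)) x with hq_def
  have hq_meas : Measurable q := by
    have := measurable_deriv (fun x => Real.log (p x))
    fun_prop
  have hKint (x : ℝ) := integrable_gaussianPDFReal_const_mul μ s v x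
  have hKaint (x : ℝ) : Integrable (fun a => gaussianPDFReal (s * a) v x * a) μ := by
    refine hμint.bdd_mul (c := (√(2 * Real.pi * v))⁻¹) (hKint x).aestronglyMeasurable
      (.of_forall fun a => ?_)
    rw [Real.norm_of_nonneg (gaussianPDFReal_nonneg _ _ _)]
    exact gaussianPDFReal_le _ _ _
  have hp_pos (x : ℝ) : 0 < p x := by
    refine (integral_pos_iff_support_of_nonneg
      (fun a => gaussianPDFReal_nonneg _ _ _) (hKint x)).2 ?_
    have : Function.support (fun a => gaussianPDFReal (s * a) v x) = Set.univ :=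
      Set.eq_univ_of_forall fun a => (gaussianPDFReal_pos _ _ _ hv).ne'
    simp [this]
  have hqp (x : ℝ) : q x * p x = N x := by
    have hd : ∫ a, -((x - s * a) / v) * gaussianPDFReal (s * a) v x ∂μ
        = s / v * N x - x / v * p x := by
      rw [hN_def, hp_def, ← integral_const_mul, ← integral_const_mul,
        ← integral_sub ((hKaint x).const_mul _) ((hKint x).const_mul _)]
      refine integral_congr_ae (.of_forall fun a => ?_)
      ring
    have h := (hasDerivAt_integral_gaussianPDFReal μ hμint s v x).log (hp_pos x).ne'
    have hpx := (hp_pos x).ne'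
    simp only [hq_def]
    rw [h.deriv, hd, hv_coe]
    change (x / s + s * σ ^ 2 * (_ / p x)) * p x = N x
    field_simp
    ring
  -- transfer of integrals to the product space
  have hlaw := map_prodMk_add_gaussian hX₀ hε hεlaw hindep s (s * σ) v hv
    (by rw [hv_coe]; ring)
  have hKmeas := measurable_gaussianPDFReal_const_mul_uncurry s v
  have hdens_meas : Measurable fun z : ℝ × ℝ => gaussianPDF (s * z.1) v z.2 :=
    hKmeas.ennreal_ofReal
  have htransfer_int {f : ℝ × ℝ → ℝ} (hf : Measurable f) :
      Integrable (fun ω => f (X₀ ω, Xt ω)) P ↔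
        Integrable (fun z => gaussianPDFReal (s * z.1) v z.2 * f z) (μ.prod volume) := by
    have h := integrable_map_measure (μ := P) (f := fun ω => (X₀ ω, Xt ω)) (g := f)
      hf.aestronglyMeasurable (by fun_prop)
    rw [hlaw, integrable_withDensity_iff_integrable_smul' hdens_meas
      (.of_forall fun _ => gaussianPDF_lt_top)] at h
    simpa [toReal_gaussianPDF, Function.comp_def] using h.symm
  have htransfer {f : ℝ × ℝ → ℝ} (hf : Measurable f)
      (hfint : Integrable (fun ω => f (X₀ ω, Xt ω)) P) :
      ∫ ω, f (X₀ ω, Xt ω) ∂P = ∫ x, ∫ a, gaussianPDFReal (s * a) v x * f (a, x) ∂μ := by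
    have h := integral_map (μ := P) (φ := fun ω => (X₀ ω, Xt ω)) (f := f)
      (by fun_prop) hf.aestronglyMeasurable
    rw [← h, hlaw, integral_withDensity_eq_integral_toReal_smul hdens_meas
      (.of_forall fun _ => gaussianPDF_lt_top)]
    simp only [toReal_gaussianPDF, smul_eq_mul]
    exact integral_prod_symm _ ((htransfer_int hf).1 hfint)
  have hN_int : Integrable N volume :=
    ((htransfer_int (f := Prod.fst) (by fun_prop)).1 hX₀int).integral_prod_right
  have hqXt_int : Integrable (fun ω => q (Xt ω)) P := by
    refine (htransfer_int (f := fun z => q z.2) (by fun_prop)).2 ?_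
    rw [integrable_prod_iff' (Measurable.aestronglyMeasurable (by fun_prop))]
    refine ⟨.of_forall fun x => (hKint x).mul_const (q x), hN_int.norm.congr (.of_forall fun x => ?_)⟩
    simp only [norm_mul, Real.norm_of_nonneg (gaussianPDFReal_nonneg _ _ _)]
    rw [integral_mul_const, ← hqp, norm_mul, Real.norm_of_nonneg (hp_pos x).le, mul_comm]
  refine (ae_eq_condExp_of_forall_setIntegral_eq hXt_meas.comap_le hX₀int
    (fun _ _ _ => hqXt_int.integrableOn) ?_
    (hq_meas.comp (comap_measurable Xt)).aestronglyMeasurable).symm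
  rintro _ ⟨B, hB, rfl⟩ -
  have hB' := hXt_meas hB
  have hmeas_ind {f : ℝ × ℝ → ℝ} (hf : Measurable f) :
      Measurable fun z : ℝ × ℝ => B.indicator 1 z.2 * f z := by
    have : Measurable (B.indicator (1 : ℝ → ℝ)) := measurable_one.indicator hB
    fun_prop
  have hind (g : Ω → ℝ) : (Xt ⁻¹' B).indicator g = fun ω => B.indicator 1 (Xt ω) * g ω := by
    ext ω
    by_cases h : Xt ω ∈ B <;> simp [h]
  rw [← integral_indicator hB', ← integral_indicator hB', hind, hind,
    htransfer (hmeas_ind (f := fun z => q z.2) (by fun_prop)) ?_,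
    htransfer (hmeas_ind (f := Prod.fst) (by fun_prop)) ?_]
  · refine integral_congr_ae (.of_forall fun x => ?_)
    simp only [mul_left_comm _ (B.indicator 1 x)]
    rw [integral_const_mul, integral_const_mul, integral_mul_const, mul_comm _ (q x)]
    exact congrArg _ (hqp x)
  · exact hind X₀ ▸ hX₀int.indicator hB'
  · exact hind (fun ω => q (Xt ω)) ▸ hqXt_int.indicator hB'
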